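/- There is no standard braiding matrix (q_{ij})_{1≤i,j≤5} with entries in k^× whose associated generalized Cartan matrix is the 5×5 matrix C_0 with rows (2, −2, 0, 0, −1), (−1, 2, −1, 0, 0), (0, −1, 2, −1, 0), (0, 0, −1, 2, −1), (−1, 0, 0, −1, 2); that is, there is no standard (q_{ij}) with m_{12}(E) = 2, m_{21}(E) = m_{23}(E) = m_{32}(E) = m_{34}(E) = m_{43}(E) = m_{45}(E) = m_{54}(E) = m_{15}(E) = m_{51}(E) = 1, and m_{ij}(E) = 0 for all remaining pairs i ≠ j. -/

import Mathlib

/-- The quantum number `(m)_t = 1 + t + ⋯ + t^{m−1}`. -/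
def qnum {k : Type*} [Field k] (t : k) (m : ℕ) : k := ∑ i ∈ Finset.range m, t ^ i

/-- The bicharacter `χ : ℤ^n × ℤ^n → k^×` determined by `χ(e_i, e_j) = q_{ij}`. -/
def chiOf {k : Type*} [Field k] {n : ℕ} (q : Fin n → Fin n → k) (a b : Fin n → ℤ) : k :=
  ∏ i, ∏ j, q i j ^ (a i * b j)

/-- The set of `m ∈ ℕ₀` with `(m+1)_{q̃_{ii}} (q̃_{ii}^m q̃_{ij} q̃_{ji} − 1) = 0`, where
`q̃_{ij} = χ(f_i, f_j)` is the braiding matrix with respect to the ordered basis `F`. -/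
def mSet {k : Type*} [Field k] {n : ℕ} (q : Fin n → Fin n → k)
    (F : Fin n → Fin n → ℤ) (i j : Fin n) : Set ℕ :=
  { m | qnum (chiOf q (F i) (F i)) (m + 1) *
      ((chiOf q (F i) (F i)) ^ m * chiOf q (F i) (F j) * chiOf q (F j) (F i) - 1) = 0 }

/-- `m_{ij}(F)` is defined iff the above set is nonempty. -/
def mDef {k : Type*} [Field k] {n : ℕ} (q : Fin n → Fin n → k)
    (F : Fin n → Fin n → ℤ) (i j : Fin n) : Prop :=
  (mSet q F i j).Nonempty

/-- `m_{ij}(F)`, the minimal element of the above set (junk value `0` if undefined). -/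
noncomputable def mVal {k : Type*} [Field k] {n : ℕ} (q : Fin n → Fin n → k)
    (F : Fin n → Fin n → ℤ) (i j : Fin n) : ℕ :=
  sInf (mSet q F i j)

/-- The pseudo-reflection `s_{i,F}` applied to the ordered basis `F`:
`f_j ↦ f_j + m_{ij}(F) f_i` for `j ≠ i`, and `f_i ↦ −f_i`. -/
noncomputable def reflectBasis {k : Type*} [Field k] {n : ℕ} (q : Fin n → Fin n → k)
    (F : Fin n → Fin n → ℤ) (i : Fin n) : Fin n → Fin n → ℤ :=
  fun j => if j = i then -F i else F j + (mVal q F i j : ℤ) • F i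

/-- The canonical (ordered) basis `E = (e_1, …, e_n)` of `ℤ^n`. -/
def canBasis {n : ℕ} : Fin n → Fin n → ℤ := fun i j => if j = i then 1 else 0

/-- The set of points `𝔓(χ)` of the Weyl groupoid: the smallest set of ordered bases of `ℤ^n`
containing `E` and closed under `F ↦ s_{i,F}(F)` whenever defined. -/
inductive InWeylOrbit {k : Type*} [Field k] {n : ℕ} (q : Fin n → Fin n → k) :
    (Fin n → Fin n → ℤ) → Prop
  | base : InWeylOrbit q canBasis
  | step (F : Fin n → Fin n → ℤ) (i : Fin n) (hF : InWeylOrbit q F)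
      (hdef : ∀ j, j ≠ i → mDef q F i j) : InWeylOrbit q (reflectBasis q F i)

/-- The braiding matrix `(q_{ij})` is standard: for every `F ∈ 𝔓(χ)` all `m_{ij}(F)` are
defined, and they are unchanged by all the reflections `s_{l,F}`. -/
def IsStandard {k : Type*} [Field k] {n : ℕ} (q : Fin n → Fin n → k) : Prop :=
  (∀ F, InWeylOrbit q F → ∀ i j : Fin n, i ≠ j → mDef q F i j) ∧
  (∀ F, InWeylOrbit q F → ∀ (l i j : Fin n), i ≠ j →
    mVal q (reflectBasis q F l) i j = mVal q F i j)

/-- The generalized Cartan matrix associated to a standard braiding: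
`a_{ii} = 2` and `a_{ij} = −m_{ij}(E)` for `i ≠ j`. -/
noncomputable def cartanOf {k : Type*} [Field k] {n : ℕ} (q : Fin n → Fin n → k) : Fin n → Fin n → ℤ :=
  fun i j => if i = j then 2 else -(mVal q canBasis i j : ℤ)

section aux
variable {k : Type*} [Field k] {n : ℕ}

lemma chi_add_left (q : Fin n → Fin n → k) (hq : ∀ i j, q i j ≠ 0) (a b c : Fin n → ℤ) :
    chiOf q (a + b) c = chiOf q a c * chiOf q b c := by
  simp only [chiOf, ← Finset.prod_mul_distrib]
  refine Finset.prod_congr rfl fun i _ => Finset.prod_congr rfl fun j _ => ?_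
  rw [← zpow_add₀ (hq i j), Pi.add_apply, add_mul]

lemma chi_add_right (q : Fin n → Fin n → k) (hq : ∀ i j, q i j ≠ 0) (a b c : Fin n → ℤ) :
    chiOf q c (a + b) = chiOf q c a * chiOf q c b := by
  simp only [chiOf, ← Finset.prod_mul_distrib]
  refine Finset.prod_congr rfl fun i _ => Finset.prod_congr rfl fun j _ => ?_
  rw [← zpow_add₀ (hq i j), Pi.add_apply, mul_add]

/-- diagonal entries -/
def XX (q : Fin n → Fin n → k) (F : Fin n → Fin n → ℤ) (i : Fin n) : k := chiOf q (F i) (F i)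
/-- edge labels -/
def YY (q : Fin n → Fin n → k) (F : Fin n → Fin n → ℤ) (i j : Fin n) : k :=
  chiOf q (F i) (F j) * chiOf q (F j) (F i)

lemma YY_comm (q : Fin n → Fin n → k) (F : Fin n → Fin n → ℤ) (i j : Fin n) :
    YY q F i j = YY q F j i := mul_comm _ _

lemma mem_mSet (q : Fin n → Fin n → k) (F : Fin n → Fin n → ℤ) (i j : Fin n) (m : ℕ) :
    m ∈ mSet q F i j ↔ qnum (XX q F i) (m + 1) * (XX q F i ^ m * YY q F i j - 1) = 0 := by
  simp only [mSet, Set.mem_ofPred_eq, XX, YY, mul_assoc]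

lemma of_m0 {q : Fin n → Fin n → k} {F : Fin n → Fin n → ℤ} {i j : Fin n}
    (hd : mDef q F i j) (h : mVal q F i j = 0) : YY q F i j = 1 := by
  have h1 := Nat.sInf_mem hd
  change mVal q F i j ∈ _ at h1
  rw [h, mem_mSet] at h1
  simp [qnum] at h1
  linear_combination h1

lemma of_m1 {q : Fin n → Fin n → k} {F : Fin n → Fin n → ℤ} {i j : Fin n}
    (hd : mDef q F i j) (h : mVal q F i j = 1) :
    YY q F i j ≠ 1 ∧ (XX q F i = -1 ∨ XX q F i * YY q F i j = 1) := by
  have h1 := Nat.sInf_mem hd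
  change mVal q F i j ∈ _ at h1
  have h0 : 0 ∉ mSet q F i j := Nat.notMem_of_lt_sInf (by change 0 < mVal q F i j; omega)
  rw [h, mem_mSet] at h1
  rw [mem_mSet] at h0
  refine ⟨fun h => h0 (by simp [h]), ?_⟩
  rcases mul_eq_zero.1 h1 with h1 | h1
  · left; simp [qnum, Finset.sum_range_succ] at h1; linear_combination h1
  · right; linear_combination h1

lemma of_m2 {q : Fin n → Fin n → k} {F : Fin n → Fin n → ℤ} {i j : Fin n}
    (h : mVal q F i j = 2) :
    YY q F i j ≠ 1 ∧ XX q F i ≠ -1 ∧ XX q F i * YY q F i j ≠ 1 := by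
  have h0 : 0 ∉ mSet q F i j := Nat.notMem_of_lt_sInf (by change 0 < mVal q F i j; omega)
  have h1 : 1 ∉ mSet q F i j := Nat.notMem_of_lt_sInf (by change 1 < mVal q F i j; omega)
  rw [mem_mSet] at h0 h1
  refine ⟨fun h => h0 (by simp [h]), fun h => h1 ?_, fun h => h1 ?_⟩
  · simp [qnum, Finset.sum_range_succ, h]
  · simp [h]

lemma XX_refl {q : Fin n → Fin n → k} (hq : ∀ i j, q i j ≠ 0) {F : Fin n → Fin n → ℤ}
    {i j : Fin n} (hij : j ≠ i) (h : mVal q F i j = 1) :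
    XX q (reflectBasis q F i) j = XX q F j * YY q F i j * XX q F i := by
  simp only [XX, YY, reflectBasis, if_neg hij, h, Nat.cast_one, one_smul, chi_add_left q hq,
    chi_add_right q hq]
  ring

lemma YY_refl11 {q : Fin n → Fin n → k} (hq : ∀ i j, q i j ≠ 0) {F : Fin n → Fin n → ℤ}
    {i j l : Fin n} (hij : j ≠ i) (hil : l ≠ i) (h : mVal q F i j = 1) (h' : mVal q F i l = 1) :
    YY q (reflectBasis q F i) j l = YY q F j l * YY q F i j * YY q F i l * XX q F i ^ 2 := by
  simp only [XX, YY, reflectBasis, if_neg hij, if_neg hil, h, h', Nat.cast_one, one_smul,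
    chi_add_left q hq, chi_add_right q hq]
  ring

lemma YY_refl21 {q : Fin n → Fin n → k} (hq : ∀ i j, q i j ≠ 0) {F : Fin n → Fin n → ℤ}
    {i j l : Fin n} (hij : j ≠ i) (hil : l ≠ i) (h : mVal q F i j = 2) (h' : mVal q F i l = 1) :
    YY q (reflectBasis q F i) j l = YY q F j l * YY q F i j * YY q F i l ^ 2 * XX q F i ^ 4 := by
  simp only [XX, YY, reflectBasis, if_neg hij, if_neg hil, h, h', Nat.cast_one, one_smul,
    Nat.cast_ofNat, two_smul, chi_add_left q hq, chi_add_right q hq]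
  ring

lemma orbit_refl {q : Fin n → Fin n → k} (hs : IsStandard q) {F : Fin n → Fin n → ℤ}
    (hF : InWeylOrbit q F) (i : Fin n) : InWeylOrbit q (reflectBasis q F i) :=
  .step F i hF fun j hj => hs.1 F hF i j hj.symm

lemma mVal_orbit {q : Fin n → Fin n → k} (hs : IsStandard q) {F : Fin n → Fin n → ℤ}
    (hF : InWeylOrbit q F) {i j : Fin n} (hij : i ≠ j) : mVal q F i j = mVal q canBasis i j := by
  induction hF with
  | base => rfl
  | step F l hF _ ih => rw [hs.2 F hF l i j hij, ih]

/-- the dichotomy at a vertex with two non-adjacent simple neighbours -/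
lemma vertex {q : Fin n → Fin n → k} (hq : ∀ i j, q i j ≠ 0) (hs : IsStandard q)
    {F : Fin n → Fin n → ℤ} (hF : InWeylOrbit q F) {i j l : Fin n} (hij : j ≠ i) (hil : l ≠ i)
    (hjl : j ≠ l) (h : mVal q canBasis i j = 1) (h' : mVal q canBasis i l = 1)
    (h0 : mVal q canBasis j l = 0) :
    (XX q F i = -1 ∧ YY q F i j * YY q F i l = 1) ∨
    (XX q F i ≠ -1 ∧ XX q F i * YY q F i j = 1 ∧ XX q F i * YY q F i l = 1) := by
  have hj := mVal_orbit hs hF hij.symm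
  have hl := mVal_orbit hs hF hil.symm
  rw [h] at hj
  rw [h'] at hl
  by_cases hX : XX q F i = -1
  · refine Or.inl ⟨hX, ?_⟩
    have e := YY_refl11 hq hij hil hj hl
    have hF' := orbit_refl hs hF i
    rw [of_m0 (hs.1 _ hF' j l hjl) ((mVal_orbit hs hF' hjl).trans h0),
      of_m0 (hs.1 _ hF j l hjl) ((mVal_orbit hs hF hjl).trans h0), hX] at e
    linear_combination -e
  · right
    exact ⟨hX, (of_m1 (hs.1 F hF i j hij.symm) hj).2.resolve_left hX,
      (of_m1 (hs.1 F hF i l hil.symm) hl).2.resolve_left hX⟩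

lemma pm {a b x : k} (h : (x = -1 ∧ a * b = 1) ∨ (x ≠ -1 ∧ x * a = 1 ∧ x * b = 1)) :
    a = b ∨ a * b = 1 := by
  rcases h with h | ⟨_, h1, h2⟩
  · exact Or.inr h.2
  · left
    have hx : x ≠ 0 := by rintro rfl; simp at h1
    exact mul_left_cancel₀ hx (h1.trans h2.symm)

lemma pm_trans {a b c : k} (h : a = b ∨ a * b = 1) (h' : b = c ∨ b * c = 1) :
    a = c ∨ a * c = 1 := by
  rcases h with rfl | h
  · exact h'
  · rcases h' with rfl | h'
    · exact Or.inr h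
    · left
      linear_combination c * h - a * h'
end aux

/-- There is no standard braiding matrix whose generalized Cartan matrix is the
non-symmetrizable matrix `C₀` with rows `(2,−2,0,0,−1)`, `(−1,2,−1,0,0)`, `(0,−1,2,−1,0)`,
`(0,0,−1,2,−1)`, `(−1,0,0,−1,2)` (a cycle of length 5 with one double edge). -/
theorem stmt_4 {k : Type*} [Field k] [IsAlgClosed k] [CharZero k] :
    ¬ ∃ q : Fin 5 → Fin 5 → k, (∀ i j, q i j ≠ 0) ∧ IsStandard q ∧
      mVal q canBasis 0 1 = 2 ∧ mVal q canBasis 1 0 = 1 ∧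
      mVal q canBasis 1 2 = 1 ∧ mVal q canBasis 2 1 = 1 ∧
      mVal q canBasis 2 3 = 1 ∧ mVal q canBasis 3 2 = 1 ∧
      mVal q canBasis 3 4 = 1 ∧ mVal q canBasis 4 3 = 1 ∧
      mVal q canBasis 0 4 = 1 ∧ mVal q canBasis 4 0 = 1 ∧
      mVal q canBasis 0 2 = 0 ∧ mVal q canBasis 2 0 = 0 ∧
      mVal q canBasis 0 3 = 0 ∧ mVal q canBasis 3 0 = 0 ∧
      mVal q canBasis 1 3 = 0 ∧ mVal q canBasis 3 1 = 0 ∧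
      mVal q canBasis 1 4 = 0 ∧ mVal q canBasis 4 1 = 0 ∧
      mVal q canBasis 2 4 = 0 ∧ mVal q canBasis 4 2 = 0 := by
  rintro ⟨q, hq, hs, h01, h10, h12, h21, h23, h32, h34, h43, h04, h40, h02, h20, h03, h30,
    h13, h31, h14, h41, h24, h42⟩
  have v1 : ∀ F, InWeylOrbit q F → _ := fun F hF =>
    vertex hq hs hF (i := 1) (j := 0) (l := 2) (by decide) (by decide) (by decide) h10 h12 h02
  have v2 : ∀ F, InWeylOrbit q F → _ := fun F hF =>
    vertex hq hs hF (i := 2) (j := 1) (l := 3) (by decide) (by decide) (by decide) h21 h23 h13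
  have v3 : ∀ F, InWeylOrbit q F → _ := fun F hF =>
    vertex hq hs hF (i := 3) (j := 2) (l := 4) (by decide) (by decide) (by decide) h32 h34 h24
  have v4 : ∀ F, InWeylOrbit q F → _ := fun F hF =>
    vertex hq hs hF (i := 4) (j := 3) (l := 0) (by decide) (by decide) (by decide) h43 h40 h30
  have P1 : ∀ F, InWeylOrbit q F → XX q F 0 ^ 3 = 1 ∧ XX q F 0 ≠ 1 ∧ XX q F 0 ≠ -1 ∧
      YY q F 1 0 = XX q F 0 ∧ XX q F 0 * YY q F 4 0 = 1 := by
    intro F hF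
    have m01 := (mVal_orbit hs hF (i := 0) (j := 1) (by decide)).trans h01
    have m04 := (mVal_orbit hs hF (i := 0) (j := 4) (by decide)).trans h04
    obtain ⟨a1, a2, a3⟩ := of_m2 m01
    have b := (of_m1 (hs.1 F hF 0 4 (by decide)) m04).2.resolve_left a2
    have e := YY_refl21 hq (F := F) (i := 0) (j := 1) (l := 4) (by decide) (by decide) m01 m04
    have hF' := orbit_refl hs hF 0
    rw [of_m0 (hs.1 _ hF' 1 4 (by decide)) ((mVal_orbit hs hF' (by decide)).trans h14),
      of_m0 (hs.1 _ hF 1 4 (by decide)) ((mVal_orbit hs hF (by decide)).trans h14)] at e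
    have w1 := pm (v1 F hF)
    have w2 := pm (v2 F hF)
    have w3 := pm (v3 F hF)
    have w4 := pm (v4 F hF)
    rw [YY_comm q F 2 1] at w2
    rw [YY_comm q F 3 2] at w3
    rw [YY_comm q F 4 3] at w4
    have w := pm_trans (pm_trans (pm_trans w1 w2) w3) w4
    rw [YY_comm q F 0 1] at *
    rw [YY_comm q F 0 4] at *
    generalize XX q F 0 = x at *
    generalize YY q F 1 0 = y at *
    generalize YY q F 4 0 = z at *
    have c : x ^ 2 * y = 1 := by
      linear_combination -e - y * x ^ 2 * (x * z + 1) * b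
    rcases w with rfl | w
    · exact absurd b a3
    · have hy : y = x := by linear_combination x * w - y * b
      subst hy
      exact ⟨by linear_combination c, a1, a2, rfl, b⟩
  have P2 : ∀ F, InWeylOrbit q F → XX q F 1 ≠ -1 := by
    intro F hF hX
    have m10 := (mVal_orbit hs hF (i := 1) (j := 0) (by decide)).trans h10
    have e := XX_refl hq (F := F) (i := 1) (j := 0) (by decide) m10
    obtain ⟨c, -, -, d, -⟩ := P1 F hF
    have c' := (P1 _ (orbit_refl hs hF 1)).1
    rw [e, d, hX] at c'
    have : (2 : k) = 0 := by linear_combination -c' - (XX q F 0 ^ 3 + 1) * c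
    exact two_ne_zero this
  have P4 : ∀ F, InWeylOrbit q F → XX q F 4 ≠ -1 := by
    intro F hF hX
    have m40 := (mVal_orbit hs hF (i := 4) (j := 0) (by decide)).trans h40
    have e := XX_refl hq (F := F) (i := 4) (j := 0) (by decide) m40
    obtain ⟨-, -, -, -, d⟩ := P1 F hF
    have c' := (P1 _ (orbit_refl hs hF 4)).2.2.1
    rw [e, d, hX] at c'
    simp at c'
  have hE : InWeylOrbit q canBasis := .base
  obtain ⟨c, x1, x2, d, d'⟩ := P1 _ hE
  obtain ⟨-, f1, f2⟩ := (v1 _ hE).resolve_left fun h => P2 _ hE h.1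
  obtain ⟨-, g1, g2⟩ := (v4 _ hE).resolve_left fun h => P4 _ hE h.1
  have X2 : XX q canBasis 2 ≠ -1 := by
    intro hX
    have e := XX_refl hq (F := canBasis) (i := 2) (j := 1) (by decide) h21
    apply P2 _ (orbit_refl hs hE 2)
    rw [e, hX, YY_comm q _ 2 1, f2]; ring
  have X3 : XX q canBasis 3 ≠ -1 := by
    intro hX
    have e := XX_refl hq (F := canBasis) (i := 3) (j := 4) (by decide) h34
    apply P4 _ (orbit_refl hs hE 3)
    rw [e, hX, YY_comm q _ 3 4, g1]; ring
  have w1 := v1 _ hE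
  have can : ∀ {a b x : k}, x * a = 1 → x * b = 1 → a = b := by
    intro a b x h1 h2
    have hx : x ≠ 0 := by rintro rfl; simp at h1
    exact mul_left_cancel₀ hx (h1.trans h2.symm)
  have i1 := can f1 f2
  obtain ⟨-, j1, j2⟩ := (v2 _ hE).resolve_left fun h => X2 h.1
  obtain ⟨-, l1, l2⟩ := (v3 _ hE).resolve_left fun h => X3 h.1
  have i2 := can j1 j2
  have i3 := can l1 l2
  have i4 := can g1 g2
  rw [YY_comm q _ 2 1] at i2
  rw [YY_comm q _ 3 2] at i3
  rw [YY_comm q _ 4 3] at i4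
  have i5 : XX q canBasis 0 * XX q canBasis 0 = 1 := by
    rw [← i4, ← i3, ← i2, ← i1, d] at d'
    exact d'
  apply x1
  linear_combination c - XX q canBasis 0 * i5
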